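/- Let P and Q be probability measures on (Ω,Σ) with P absolutely continuous with respect to Q, and f a proper lsc convex function with f(1)=0, f(x)=∞ for x<0, finite near 1. Then the f-divergence satisfies D_f(P‖Q) = ∫_Ω f(dP/dQ) dQ = sup over bounded measurable h of ( ∫ h dP − ∫ f*(h) dQ ). -/

import Mathlib

open MeasureTheory Filter ENNReal

/-- Convex conjugate of an extended-real-valued function on ℝ. -/
noncomputable def fStar (f : ℝ → EReal) (s : ℝ) : EReal := ⨆ x : ℝ, ((s * x : ℝ) : EReal) - f x

/-- Positive part of an extended real, as an extended nonnegative real. -/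
noncomputable def erealPos (x : EReal) : ℝ≥0∞ := if x = ⊤ then ⊤ else ENNReal.ofReal x.toReal

/-- Integral of an extended-real-valued function, with values in [-∞,∞]. -/
noncomputable def eintegral {Ω : Type*} [MeasurableSpace Ω] (Q : Measure Ω) (g : Ω → EReal) : EReal :=
  ((∫⁻ x, erealPos (g x) ∂Q) : EReal) - ((∫⁻ x, erealPos (-(g x)) ∂Q) : EReal)

/-- The set B(Ω,Σ) of bounded measurable real-valued functions. -/
def BM (Ω : Type*) [MeasurableSpace Ω] : Set (Ω → ℝ) :=
  {g | Measurable g ∧ ∃ C, ∀ x, |g x| ≤ C}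

/-- R(h) = inf_{b ∈ ℝ} ( E_Q[f*(h + b)] − b ). -/
noncomputable def Rfun {Ω : Type*} [MeasurableSpace Ω] (Q : Measure Ω) (f : ℝ → EReal)
    (h : Ω → ℝ) : EReal :=
  ⨅ b : ℝ, eintegral Q (fun x => fStar f (h x + b)) - (b : EReal)


lemma aux_sep (f : ℝ → EReal) (hlsc : LowerSemicontinuous f)
    (hconv : ∀ (x y a b : ℝ), 0 < a → 0 < b → a + b = 1 →
      f (a * x + b * y) ≤ (a : EReal) * f x + (b : EReal) * f y)
    (h1 : f 1 = 0) (x₀ t : ℝ) (ht : (t : EReal) < f x₀) :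
    ∃ α β u : ℝ, 0 ≤ β ∧ α * x₀ + β * t < u ∧ ∀ x r : ℝ, f x ≤ r → u < α * x + β * r := by
  set E : Set (ℝ × ℝ) := {p | f p.1 ≤ (p.2 : EReal)} with hE
  have hcl : IsClosed E := by
    have h := hlsc.isClosed_epigraph
    have hc : Continuous (fun p : ℝ × ℝ => (p.1, (p.2 : EReal))) :=
      continuous_fst.prodMk (continuous_coe_real_ereal.comp continuous_snd)
    exact h.preimage hc
  have hcv : Convex ℝ E := by
    rw [convex_iff_forall_pos]
    rintro ⟨x, r⟩ hx ⟨y, s⟩ hy a b ha hb hab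
    simp only [hE, Set.mem_ofPred_eq] at hx hy ⊢
    refine (hconv x y a b ha hb hab).trans ?_
    have e : (((a • (x, r) + b • (y, s) : ℝ × ℝ).2 : ℝ) : EReal)
      = (a : EReal) * r + (b : EReal) * s := by simp
    rw [e]
    gcongr
  have hnot : (x₀, t) ∉ E := by simpa [hE] using ht
  obtain ⟨φ, u, hu1, hu2⟩ := geometric_hahn_banach_point_closed hcv hcl hnot
  have hφ : ∀ x r : ℝ, φ (x, r) = φ (1, 0) * x + φ (0, 1) * r := by
    intro x r
    have : ((x, r) : ℝ × ℝ) = x • (1, 0) + r • (0, 1) := by simp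
    rw [this, map_add, map_smul, map_smul]
    simp [mul_comm]
  have key : ∀ x r : ℝ, f x ≤ r → u < φ (1, 0) * x + φ (0, 1) * r := by
    intro x r h
    rw [← hφ]
    exact hu2 _ h
  refine ⟨φ (1, 0), φ (0, 1), u, ?_, by rw [← hφ]; exact hu1, key⟩
  by_contra hneg
  push Not at hneg
  set β := φ (0, 1)
  set α := φ (1, 0)
  have := key 1 (|u - α| / (-β)) (by
    rw [h1]
    exact_mod_cast div_nonneg (abs_nonneg _) (by linarith))
  have e : β * (|u - α| / (-β)) = -|u - α| := by
    have : β ≠ 0 := hneg.ne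
    field_simp
  rw [e] at this
  have := neg_abs_le (u - α)
  linarith

lemma aux_pos (f : ℝ → EReal) (hbot : ∀ x, f x ≠ ⊥) (α β u : ℝ) (hβ : 0 < β) (x₀ t : ℝ)
    (h0 : α * x₀ + β * t < u) (h : ∀ x r : ℝ, f x ≤ r → u < α * x + β * r) :
    ∃ a b : ℝ, (∀ x : ℝ, ((a * x + b : ℝ) : EReal) ≤ f x) ∧ t < a * x₀ + b := by
  refine ⟨-α / β, u / β, fun x => ?_, ?_⟩
  · rcases eq_or_ne (f x) ⊤ with hx | hx
    · simp [hx]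
    · lift f x to ℝ using ⟨hx, hbot x⟩ with r hr
      have := h x r hr.ge
      rw [EReal.coe_le_coe_iff]
      have : -α / β * x + u / β = (u - α * x) / β := by ring
      rw [this, div_le_iff₀ hβ]
      linarith
  · have : -α / β * x₀ + u / β = (u - α * x₀) / β := by ring
    rw [this, lt_div_iff₀ hβ]
    linarith

lemma aux_minor (f : ℝ → EReal) (hlsc : LowerSemicontinuous f)
    (hconv : ∀ (x y a b : ℝ), 0 < a → 0 < b → a + b = 1 →
      f (a * x + b * y) ≤ (a : EReal) * f x + (b : EReal) * f y)
    (hbot : ∀ x, f x ≠ ⊥) (h1 : f 1 = 0) (x₀ t : ℝ) (ht : (t : EReal) < f x₀) :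
    ∃ a b : ℝ, (∀ x : ℝ, ((a * x + b : ℝ) : EReal) ≤ f x) ∧ t < a * x₀ + b := by
  have base : ∃ a b : ℝ, (∀ x : ℝ, ((a * x + b : ℝ) : EReal) ≤ f x) := by
    obtain ⟨α, β, u, hβ, h0, h⟩ := aux_sep f hlsc hconv h1 1 (-1)
      (by rw [h1]; exact_mod_cast (by norm_num : (-1 : ℝ) < 0))
    have := h 1 0 (by simp [h1])
    obtain ⟨a, b, hab, _⟩ := aux_pos f hbot α β u (by linarith) 1 (-1) h0 h
    exact ⟨a, b, hab⟩
  obtain ⟨α, β, u, hβ, h0, h⟩ := aux_sep f hlsc hconv h1 x₀ t ht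
  rcases hβ.lt_or_eq with hβ | hβ
  · exact aux_pos f hbot α β u hβ x₀ t h0 h
  · obtain ⟨a, b, hab⟩ := base
    subst hβ
    simp only [zero_mul, add_zero] at h0 h
    set d := u - α * x₀ with hd
    have hdpos : 0 < d := by linarith
    set l := (|t - (a * x₀ + b)| + 1) / d with hl
    have hlpos : 0 < l := by positivity
    refine ⟨a - l * α, b + l * u, fun x => ?_, ?_⟩
    · rcases eq_or_ne (f x) ⊤ with hx | hx
      · simp [hx]
      · refine le_trans ?_ (hab x)
        have hx' := h x (f x).toReal (EReal.le_coe_toReal hx)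
        rw [EReal.coe_le_coe_iff]
        nlinarith
    · have e : l * d = |t - (a * x₀ + b)| + 1 := by
        rw [hl]; field_simp
      have := le_abs_self (t - (a * x₀ + b))
      have : (a - l * α) * x₀ + (b + l * u) = a * x₀ + b + l * d := by rw [hd]; ring
      linarith

lemma aux_seq (f : ℝ → EReal) (hlsc : LowerSemicontinuous f)
    (hconv : ∀ (x y a b : ℝ), 0 < a → 0 < b → a + b = 1 →
      f (a * x + b * y) ≤ (a : EReal) * f x + (b : EReal) * f y)
    (hbot : ∀ x, f x ≠ ⊥) (h1 : f 1 = 0) :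
    ∃ s : ℕ → ℝ × ℝ, (∀ n (x : ℝ), (((s n).1 * x + (s n).2 : ℝ) : EReal) ≤ f x) ∧
      ∀ x t : ℝ, (t : EReal) < f x → ∃ n, t < (s n).1 * x + (s n).2 := by
  let A := {p : ℝ × ℝ // ∀ x : ℝ, ((p.1 * x + p.2 : ℝ) : EReal) ≤ f x}
  let U : A → Set (ℝ × ℝ) := fun p => {q | q.2 < p.1.1 * q.1 + p.1.2}
  obtain ⟨T, hT, hTU⟩ := TopologicalSpace.isOpen_iUnion_countable U (fun p =>
    isOpen_lt (by fun_prop) (by fun_prop))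
  have key : ∀ x t : ℝ, (t : EReal) < f x → ∃ p ∈ T, t < p.1.1 * x + p.1.2 := by
    intro x t ht
    obtain ⟨a, b, hab, h⟩ := aux_minor f hlsc hconv hbot h1 x t ht
    have : (x, t) ∈ ⋃ i, U i := Set.mem_iUnion.2 ⟨⟨(a, b), hab⟩, h⟩
    rw [← hTU] at this
    simp only [Set.mem_iUnion] at this
    obtain ⟨p, hp, hq⟩ := this
    exact ⟨p, hp, hq⟩
  have hne : T.Nonempty := by
    obtain ⟨p, hp, _⟩ := key 1 (-1) (by rw [h1]; exact_mod_cast (by norm_num : (-1 : ℝ) < 0))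
    exact ⟨p, hp⟩
  obtain ⟨g, hg⟩ := hT.exists_eq_range hne
  refine ⟨fun n => (g n).1, fun n => (g n).2, fun x t ht => ?_⟩
  obtain ⟨p, hp, h⟩ := key x t ht
  rw [hg] at hp
  obtain ⟨n, rfl⟩ := hp
  exact ⟨n, h⟩

open Classical in
noncomputable def selSeq (s : ℕ → ℝ × ℝ) : ℕ → ℝ → ℝ × ℝ
  | 0, _ => s 0
  | n + 1, x => if (selSeq s n x).1 * x + (selSeq s n x).2 < (s (n+1)).1 * x + (s (n+1)).2
      then s (n+1) else selSeq s n x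

lemma selSeq_meas (s : ℕ → ℝ × ℝ) (n : ℕ) : Measurable (selSeq s n) := by
  induction n with
  | zero => exact measurable_const
  | succ n ih =>
    have e : selSeq s (n+1) = fun x => if (selSeq s n x).1 * x + (selSeq s n x).2 <
        (s (n+1)).1 * x + (s (n+1)).2 then s (n+1) else selSeq s n x := by
      funext x; rw [selSeq]
    rw [e]
    refine Measurable.ite (measurableSet_lt ?_ ?_) measurable_const ih <;> fun_prop

lemma selSeq_mem (s : ℕ → ℝ × ℝ) (n : ℕ) (x : ℝ) : ∃ i ≤ n, selSeq s n x = s i := by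
  induction n with
  | zero => exact ⟨0, le_rfl, rfl⟩
  | succ n ih =>
    unfold selSeq
    split_ifs
    · exact ⟨_, le_rfl, rfl⟩
    · obtain ⟨i, hi, h⟩ := ih
      exact ⟨i, by omega, h⟩

lemma selSeq_bdd (s : ℕ → ℝ × ℝ) (n : ℕ) :
    ∃ C : ℝ, ∀ x, |(selSeq s n x).1| ≤ C ∧ |(selSeq s n x).2| ≤ C := by
  refine ⟨∑ i ∈ Finset.range (n+1), (|(s i).1| + |(s i).2|), fun x => ?_⟩
  obtain ⟨i, hi, h⟩ := selSeq_mem s n x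
  have := Finset.single_le_sum (f := fun i => |(s i).1| + |(s i).2|)
    (fun i _ => by positivity) (Finset.mem_range.2 (Nat.lt_succ_of_le hi))
  rw [h]
  have h1 := abs_nonneg (s i).1
  have h2 := abs_nonneg (s i).2
  constructor <;> linarith

lemma selSeq_mono (s : ℕ → ℝ × ℝ) (x : ℝ) :
    Monotone (fun n => (selSeq s n x).1 * x + (selSeq s n x).2) := by
  refine monotone_nat_of_le_succ fun n => ?_
  simp only [selSeq]
  split_ifs with h
  · exact h.le
  · exact le_rfl

lemma selSeq_ge (s : ℕ → ℝ × ℝ) (x : ℝ) (n : ℕ) :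
    (s n).1 * x + (s n).2 ≤ (selSeq s n x).1 * x + (selSeq s n x).2 := by
  cases n with
  | zero => exact le_rfl
  | succ n =>
    simp only [selSeq]
    split_ifs with h
    · exact le_rfl
    · exact not_lt.1 h

lemma erealPos_coe (r : ℝ) : erealPos (r : EReal) = ENNReal.ofReal r := by
  simp [erealPos]

lemma erealPos_top : erealPos ⊤ = ⊤ := by simp [erealPos]

lemma erealPos_bot : erealPos ⊥ = 0 := by simp [erealPos]

lemma erealPos_mono : Monotone erealPos := by
  intro x y h
  induction x with
  | bot => simp [erealPos_bot]
  | top => rw [top_le_iff.1 h]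
  | coe x =>
    induction y with
    | bot => simp at h
    | top => simp [erealPos_top]
    | coe y =>
      rw [erealPos_coe, erealPos_coe]
      exact ENNReal.ofReal_le_ofReal (by exact_mod_cast h)

lemma erealPos_meas : Measurable erealPos := erealPos_mono.measurable

lemma eintegral_mono {Ω : Type*} [MeasurableSpace Ω] (Q : Measure Ω) {g k : Ω → EReal}
    (h : ∀ x, g x ≤ k x) : eintegral Q g ≤ eintegral Q k := by
  unfold eintegral
  apply EReal.sub_le_sub
  · exact_mod_cast lintegral_mono fun x => erealPos_mono (h x)
  · exact_mod_cast lintegral_mono fun x => erealPos_mono (EReal.neg_le_neg_iff.2 (h x))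

lemma eintegral_coe {Ω : Type*} [MeasurableSpace Ω] (Q : Measure Ω) {k : Ω → ℝ}
    (hk : Integrable k Q) : eintegral Q (fun x => (k x : EReal)) = ((∫ x, k x ∂Q : ℝ) : EReal) := by
  unfold eintegral
  rw [integral_eq_lintegral_pos_part_sub_lintegral_neg_part hk]
  simp_rw [← EReal.coe_neg, erealPos_coe]
  have h1 : ∫⁻ x, ENNReal.ofReal (k x) ∂Q ≠ ⊤ := hk.lintegral_lt_top.ne
  have h2 : ∫⁻ x, ENNReal.ofReal (-k x) ∂Q ≠ ⊤ := hk.neg.lintegral_lt_top.ne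
  rw [EReal.coe_sub, EReal.coe_ennreal_toReal h1, EReal.coe_ennreal_toReal h2]

lemma coe_integral_le {Ω : Type*} [MeasurableSpace Ω] (Q : Measure Ω) {k : Ω → ℝ}
    (hk : Integrable k Q) :
    ((∫ x, k x ∂Q : ℝ) : EReal) ≤ ((∫⁻ x, ENNReal.ofReal (k x) ∂Q : ℝ≥0∞) : EReal) := by
  rw [← eintegral_coe Q hk]
  unfold eintegral
  simp_rw [← EReal.coe_neg, erealPos_coe]
  exact EReal.sub_le_of_le_add' (le_add_of_nonneg_left (EReal.coe_ennreal_nonneg _))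

lemma eintegral_eq {Ω : Type*} [MeasurableSpace Ω] (Q : Measure Ω) {g : Ω → EReal} {k : Ω → ℝ}
    (hg : Measurable g) (hkm : Measurable k) (hk : Integrable k Q) (h : ∀ x, (k x : EReal) ≤ g x) :
    eintegral Q g = ((∫ x, k x ∂Q : ℝ) : EReal)
      + ((∫⁻ x, erealPos (g x - k x) ∂Q : ℝ≥0∞) : EReal) := by
  have h1 : ∫⁻ x, ENNReal.ofReal (k x) ∂Q ≠ ⊤ := hk.lintegral_lt_top.ne
  have h2 : ∫⁻ x, ENNReal.ofReal (-k x) ∂Q ≠ ⊤ := hk.neg.lintegral_lt_top.ne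
  have h3 : ∫⁻ x, erealPos (-g x) ∂Q ≠ ⊤ := by
    refine ne_top_of_le_ne_top h2 (lintegral_mono fun x => ?_)
    have := erealPos_mono (EReal.neg_le_neg_iff.2 (h x))
    rwa [← EReal.coe_neg, erealPos_coe] at this
  have pt : ∀ x, ENNReal.ofReal (-k x) + erealPos (g x)
      = erealPos (-g x) + (ENNReal.ofReal (k x) + erealPos (g x - k x)) := by
    intro x
    have hx := h x
    generalize g x = y at *
    induction y with
    | bot => simp at hx
    | top => simp [erealPos_top]
    | coe y =>
      rw [← EReal.coe_neg, ← EReal.coe_sub, erealPos_coe, erealPos_coe, erealPos_coe]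
      have hx : k x ≤ y := by exact_mod_cast hx
      generalize k x = k at *
      rcases le_total 0 k with a | a <;> rcases le_total 0 y with b | b
      · rw [ENNReal.ofReal_of_nonpos (by linarith : -k ≤ 0),
          ENNReal.ofReal_of_nonpos (by linarith : -y ≤ 0),
          ← ENNReal.ofReal_add a (by linarith)]
        simp
      · obtain rfl : k = 0 := by linarith
        obtain rfl : y = 0 := by linarith
        simp
      · rw [ENNReal.ofReal_of_nonpos a, ENNReal.ofReal_of_nonpos (by linarith : -y ≤ 0),
          ← ENNReal.ofReal_add (by linarith) b, zero_add, zero_add]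
        congr 1; ring
      · rw [ENNReal.ofReal_of_nonpos a, ENNReal.ofReal_of_nonpos b, zero_add, add_zero,
          ← ENNReal.ofReal_add (by linarith) (by linarith)]
        congr 1; ring
  have hgm : Measurable fun x => erealPos (-g x) := erealPos_meas.comp hg.neg
  have I := lintegral_congr (μ := Q) pt
  rw [lintegral_add_left (by fun_prop), lintegral_add_left hgm,
    lintegral_add_left (by fun_prop)] at I
  rw [← eintegral_coe Q hk]
  unfold eintegral
  simp_rw [← EReal.coe_neg, erealPos_coe]
  generalize (∫⁻ x, ENNReal.ofReal (k x) ∂Q) = a at *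
  generalize (∫⁻ x, ENNReal.ofReal (-k x) ∂Q) = b at *
  generalize (∫⁻ x, erealPos (-g x) ∂Q) = c at *
  generalize (∫⁻ x, erealPos (g x) ∂Q) = d at *
  generalize (∫⁻ x, erealPos (g x - k x) ∂Q) = e at *
  lift a to NNReal using h1
  lift b to NNReal using h2
  lift c to NNReal using h3
  induction e with
  | top =>
    have : d = ⊤ := by
      simpa using I
    subst this
    have e1 : ((a : ℝ≥0∞) : EReal) = ((a : ℝ) : EReal) := rfl
    have e2 : ((b : ℝ≥0∞) : EReal) = ((b : ℝ) : EReal) := rfl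
    have e3 : ((c : ℝ≥0∞) : EReal) = ((c : ℝ) : EReal) := rfl
    rw [e1, e2, e3, ← EReal.coe_sub, EReal.coe_ennreal_top, EReal.top_sub_coe, EReal.coe_add_top]
  | coe e =>
    have : d ≠ ⊤ := by
      rintro rfl
      simp at I
      exact absurd I (by exact_mod_cast (ENNReal.coe_ne_top).symm)
    lift d to NNReal using this
    have I' : (b : ℝ) + d = c + (a + e) := by exact_mod_cast I
    have : ((d : ℝ) - c) = (a - b) + e := by linarith
    have e1 : ((a : ℝ≥0∞) : EReal) = ((a : ℝ) : EReal) := rfl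
    have e2 : ((b : ℝ≥0∞) : EReal) = ((b : ℝ) : EReal) := rfl
    have e3 : ((c : ℝ≥0∞) : EReal) = ((c : ℝ) : EReal) := rfl
    have e4 : ((d : ℝ≥0∞) : EReal) = ((d : ℝ) : EReal) := rfl
    have e5 : ((e : ℝ≥0∞) : EReal) = ((e : ℝ) : EReal) := rfl
    rw [e1, e2, e3, e4, e5, ← EReal.coe_sub, ← EReal.coe_sub, ← EReal.coe_add, this]

lemma fStar_meas (f : ℝ → EReal) (hbot : ∀ x, f x ≠ ⊥) : Measurable (fStar f) := by
  apply LowerSemicontinuous.measurable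
  apply lowerSemicontinuous_iSup
  intro x
  apply Continuous.lowerSemicontinuous
  rcases eq_or_ne (f x) ⊤ with hx | hx
  · simp only [hx, EReal.sub_top]
    exact continuous_const
  · lift f x to ℝ using ⟨hx, hbot x⟩ with r hr
    simp_rw [← EReal.coe_sub]
    exact continuous_coe_real_ereal.comp (by fun_prop)

lemma le_fStar (f : ℝ → EReal) (h1 : f 1 = 0) (s : ℝ) : (s : EReal) ≤ fStar f s := by
  refine le_trans ?_ (le_iSup _ (1 : ℝ))
  simp [h1]

lemma fStar_le (f : ℝ → EReal) (hbot : ∀ x, f x ≠ ⊥) (a b : ℝ)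
    (h : ∀ x : ℝ, ((a * x + b : ℝ) : EReal) ≤ f x) : fStar f a ≤ ((-b : ℝ) : EReal) := by
  refine iSup_le fun x => ?_
  have hx := h x
  have hb := hbot x
  generalize f x = y at *
  induction y with
  | bot => simp at hb
  | top => simp
  | coe y =>
    rw [← EReal.coe_sub, EReal.coe_le_coe_iff]
    rw [EReal.coe_le_coe_iff] at hx
    linarith

lemma fenchel_pos (f : ℝ → EReal) (hbot : ∀ x, f x ≠ ⊥) (h1 : f 1 = 0) (s x k l : ℝ) :
    ENNReal.ofReal (s * x - k - l) ≤ erealPos (f x - k) + erealPos (fStar f s - l) := by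
  have h : ((s * x : ℝ) : EReal) - f x ≤ fStar f s := le_iSup (fun x : ℝ => ((s * x : ℝ) : EReal) - f x) x
  have h' := le_fStar f h1 s
  have hb := hbot x
  generalize f x = y at *
  generalize fStar f s = z at *
  induction y with
  | bot => simp at hb
  | top => simp [erealPos_top]
  | coe y =>
    induction z with
    | bot => simp at h'
    | top => simp [erealPos_top]
    | coe z =>
      rw [← EReal.coe_sub, EReal.coe_le_coe_iff] at h
      rw [← EReal.coe_sub, ← EReal.coe_sub, erealPos_coe, erealPos_coe]
      exact (ENNReal.ofReal_le_ofReal (by linarith)).trans ENNReal.ofReal_add_le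

lemma pos_tendsto (f : ℝ → EReal) (s : ℕ → ℝ × ℝ)
    (hs : ∀ n (x : ℝ), (((s n).1 * x + (s n).2 : ℝ) : EReal) ≤ f x)
    (hs' : ∀ x t : ℝ, (t : EReal) < f x → ∃ n, t < (s n).1 * x + (s n).2) (x k : ℝ) :
    Tendsto (fun n => ENNReal.ofReal ((selSeq s n x).1 * x + (selSeq s n x).2 - k)) atTop
      (nhds (erealPos (f x - k))) := by
  have hm : Monotone (fun n => ENNReal.ofReal ((selSeq s n x).1 * x + (selSeq s n x).2 - k)) :=
    fun m n h => ENNReal.ofReal_le_ofReal (sub_le_sub_right (selSeq_mono s x h) k)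
  have := tendsto_atTop_iSup hm
  convert this using 2
  apply le_antisymm
  · refine le_of_forall_lt fun c hc => ?_
    lift c to NNReal using hc.ne_top
    have : (((c : ℝ) + k : ℝ) : EReal) < f x := by
      generalize f x = y at *
      induction y with
      | bot => simp [erealPos_bot] at hc
      | top => exact EReal.coe_lt_top _
      | coe y =>
        rw [← EReal.coe_sub, erealPos_coe, ENNReal.lt_ofReal_iff_toReal_lt ENNReal.coe_ne_top] at hc
        rw [EReal.coe_lt_coe_iff]
        simp at hc
        linarith
    obtain ⟨n, hn⟩ := hs' x _ this
    refine lt_of_lt_of_le ?_ (le_iSup _ n)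
    rw [ENNReal.lt_ofReal_iff_toReal_lt ENNReal.coe_ne_top]
    have := selSeq_ge s x n
    simp
    linarith
  · refine iSup_le fun n => ?_
    obtain ⟨i, -, hi⟩ := selSeq_mem s n x
    rw [hi, ← erealPos_coe, EReal.coe_sub]
    exact erealPos_mono (EReal.sub_le_sub (hs i x) le_rfl)

/-- Variational representation of the f-divergence: for probability measures P ≪ Q,
∫ f(dP/dQ) dQ = sup over bounded measurable h of ( ∫ h dP − ∫ f*(h) dQ ). -/
theorem fDiv_eq_sup {Ω : Type*} [MeasurableSpace Ω]
    (P Q : Measure Ω) [IsProbabilityMeasure P] [IsProbabilityMeasure Q]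
    (hPQ : P ≪ Q) (f : ℝ → EReal)
    (hlsc : LowerSemicontinuous f)
    (hconv : ∀ (x y a b : ℝ), 0 < a → 0 < b → a + b = 1 →
      f (a * x + b * y) ≤ (a : EReal) * f x + (b : EReal) * f y)
    (hbot : ∀ x, f x ≠ ⊥) (h1 : f 1 = 0) (hneg : ∀ x : ℝ, x < 0 → f x = ⊤)
    (hfin : ∃ ε > (0:ℝ), ∀ x : ℝ, |x - 1| < ε → f x ≠ ⊤) :
    eintegral Q (fun x => f ((P.rnDeriv Q x).toReal)) =
      ⨆ h ∈ BM Ω, (((∫ x, h x ∂P : ℝ)) : EReal) - eintegral Q (fun x => fStar f (h x)) := by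
  obtain ⟨s, hs, hs'⟩ := aux_seq f hlsc hconv hbot h1
  set p : Ω → ℝ := fun x => (P.rnDeriv Q x).toReal with hp
  have hpm : Measurable p := (Measure.measurable_rnDeriv P Q).ennreal_toReal
  have hpi : Integrable p Q := Measure.integrable_toReal_rnDeriv
  have hPint : ∀ h : Ω → ℝ, ∫ x, h x ∂P = ∫ x, h x * p x ∂Q := by
    intro h
    rw [← integral_rnDeriv_smul hPQ]
    simp [hp, mul_comm]
  have hbi : ∀ h : Ω → ℝ, h ∈ BM Ω → Integrable h Q ∧ Integrable (fun x => h x * p x) Q := by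
    rintro h ⟨hm, C, hC⟩
    exact ⟨Integrable.of_bound hm.aestronglyMeasurable C (.of_forall hC),
      hpi.bdd_mul hm.aestronglyMeasurable (.of_forall hC)⟩
  set k : Ω → ℝ := fun x => (s 0).1 * p x + (s 0).2 with hk
  have hkm : Measurable k := by fun_prop
  have hki : Integrable k Q := (hpi.const_mul _).add (integrable_const _)
  have hfm : Measurable (fun x => f (p x)) := hlsc.measurable.comp hpm
  have E := eintegral_eq Q hfm hkm hki (fun x => hs 0 (p x))
  apply le_antisymm
  · set R := ⨆ h ∈ BM Ω, (((∫ x, h x ∂P : ℝ)) : EReal) - eintegral Q (fun x => fStar f (h x))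
    rw [E, add_comm]
    rw [← EReal.le_sub_iff_add_le (by simp) (by simp)]
    have T := lintegral_tendsto_of_tendsto_of_monotone (μ := Q)
      (f := fun n x => ENNReal.ofReal
        ((selSeq s n (p x)).1 * p x + (selSeq s n (p x)).2 - k x))
      (F := fun x => erealPos (f (p x) - k x))
      (fun n => by
        have := (selSeq_meas s n).comp hpm
        have h1 := this.fst
        have h2 := this.snd
        simp only [Function.comp_apply] at h1 h2
        exact (((h1.mul hpm).add h2).sub hkm).ennreal_ofReal.aemeasurable)
      (.of_forall fun x m n h =>
        ENNReal.ofReal_le_ofReal (sub_le_sub_right (selSeq_mono s (p x) h) _))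
      (.of_forall fun x => pos_tendsto f s hs hs' (p x) (k x))
    refine le_of_tendsto' ((continuous_coe_ennreal_ereal.tendsto _).comp T) fun n => ?_
    simp only [Function.comp_apply]
    rw [EReal.le_sub_iff_add_le (by simp) (by simp)]
    have hm := (selSeq_meas s n).comp hpm
    obtain ⟨C, hC⟩ := selSeq_bdd s n
    have hA : (fun x => (selSeq s n (p x)).1) ∈ BM Ω := ⟨hm.fst, C, fun x => (hC _).1⟩
    have hB : (fun x => (selSeq s n (p x)).2) ∈ BM Ω := ⟨hm.snd, C, fun x => (hC _).2⟩
    refine le_trans ?_ (le_iSup₂ (f := fun h (_ : h ∈ BM Ω) =>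
      (((∫ x, h x ∂P : ℝ)) : EReal) - eintegral Q (fun x => fStar f (h x))) _ hA)
    have hgi : Integrable (fun x => (selSeq s n (p x)).1 * p x + (selSeq s n (p x)).2) Q :=
      (hbi _ hA).2.add (hbi _ hB).1
    have hle : eintegral Q (fun x => fStar f (selSeq s n (p x)).1)
        ≤ ((∫ x, -(selSeq s n (p x)).2 ∂Q : ℝ) : EReal) := by
      rw [← eintegral_coe Q (k := fun x => -(selSeq s n (p x)).2) (hbi _ hB).1.neg]
      refine eintegral_mono Q fun x => ?_
      apply fStar_le f hbot
      intro y
      obtain ⟨i, -, hi⟩ := selSeq_mem s n (p x)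
      rw [hi]
      exact hs i y
    refine le_trans ?_ (EReal.sub_le_sub le_rfl hle)
    have hsub : ∀ x, 0 ≤ (selSeq s n (p x)).1 * p x + (selSeq s n (p x)).2 - k x := fun x =>
      sub_nonneg.2 (selSeq_mono s (p x) (Nat.zero_le n))
    have hgk : Integrable (fun x => (selSeq s n (p x)).1 * p x + (selSeq s n (p x)).2 - k x) Q :=
      hgi.sub hki
    rw [← ofReal_integral_eq_lintegral_ofReal hgk (.of_forall hsub),
      EReal.coe_ennreal_ofReal, max_eq_left (integral_nonneg hsub), ← EReal.coe_add,
      ← EReal.coe_sub, EReal.coe_le_coe_iff, hPint, integral_neg,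
      integral_sub hgi hki, integral_add (hbi _ hA).2 (hbi _ hB).1]
    linarith
  · refine iSup₂_le fun h hh => ?_
    have hm := hh.1
    have E' := eintegral_eq Q ((fStar_meas f hbot).comp hm) hm (hbi h hh).1
      (fun x => le_fStar f h1 (h x))
    simp only [Function.comp_apply] at E'
    apply EReal.sub_le_of_le_add
    have E'' : eintegral Q (fun x => fStar f (h x)) = _ := E'
    rw [E, E'', hPint]
    have hi : Integrable (fun x => h x * p x - k x - h x) Q :=
      ((hbi h hh).2.sub hki).sub (hbi h hh).1
    have hle := coe_integral_le Q hi
    have hle2 : ∫⁻ x, ENNReal.ofReal (h x * p x - k x - h x) ∂Q ≤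
        ∫⁻ x, erealPos (f (p x) - k x) ∂Q + ∫⁻ x, erealPos (fStar f (h x) - h x) ∂Q := by
      have hmm : Measurable fun x => erealPos (f (p x) - k x) :=
        erealPos_meas.comp (hfm.sub (measurable_coe_real_ereal.comp hkm))
      rw [← lintegral_add_left hmm]
      exact lintegral_mono fun x => fenchel_pos f hbot h1 _ _ _ _
    have hle3 := hle.trans (EReal.coe_ennreal_le_coe_ennreal_iff.2 hle2)
    have hi2 : Integrable (fun x => h x * p x - k x) Q := (hbi h hh).2.sub hki
    rw [EReal.coe_ennreal_add, integral_sub hi2 (hbi h hh).1,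
      integral_sub (hbi h hh).2 hki] at hle3
    rw [add_add_add_comm, ← EReal.coe_add]
    rw [sub_sub, EReal.coe_sub, EReal.sub_le_iff_le_add (by simp) (by simp), add_comm] at hle3
    exact hle3
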